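/- arXiv:1411.2944 — 4 statements merged into one kernel-verified Lean document; each statement's English description precedes it below -/
import Mathlib

section
/- Let σ₀ > 0, let f be the density of a normal distribution N(μ, σ²) on ℝ with σ ≥ σ₀, let l ≥ 1 be an integer, and let K : ℝ → ℝ be a bounded measurable kernel of order l supported on [−1,1], i.e. K vanishes outside [−1,1], ∫ K(u) du = 1, and ∫ u^j K(u) du = 0 for all j = 1,…,l. Then for every t ∈ ℝ and every h > 0, the bias of the kernel density estimator satisfies |∫_ℝ (1/h) K((z−t)/h) f(z) dz − f(t)| ≤ (1.09 ‖K‖_∞ / (√(π/2) √(l!) σ₀^{l+1})) h^l. -/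
open Real MeasureTheory
open scoped BigOperators

/-- The Taylor remainder of `exp (i x)` is controlled by the first omitted term. -/
lemma norm_exp_I_mul_sub_sum_le (n : ℕ) (x : ℝ) :
    ‖Complex.exp (Complex.I * x) - ∑ j ∈ Finset.range n, (Complex.I * x) ^ j / j.factorial‖ ≤
      |x| ^ n / n.factorial := by
  have nonneg_case : ∀ n : ℕ, ∀ x : ℝ, 0 ≤ x → ∀ w : ℂ, ‖w‖ = 1 → w.re = 0 →
      ‖Complex.exp (w * x) - ∑ j ∈ Finset.range n, (w * x) ^ j / j.factorial‖ ≤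
        x ^ n / n.factorial := by
    intro n
    induction n with
    | zero =>
      intro x _ w _ hre
      simp [Complex.norm_exp, hre]
    | succ n ih =>
      intro x hx w hw hre
      have hd : ∀ y : ℝ, HasDerivAt
          (fun y : ℝ => Complex.exp (w * y) -
            ∑ j ∈ Finset.range (n + 1), (w * y) ^ j / j.factorial)
          (w * (Complex.exp (w * y) - ∑ j ∈ Finset.range n, (w * y) ^ j / j.factorial)) y := by
        intro y
        have hlin : HasDerivAt (fun y : ℝ => w * (y : ℂ)) w y := by
          simpa using (Complex.ofRealCLM.hasDerivAt (x := y)).const_mul w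
        have hsum : HasDerivAt
            (fun y : ℝ => ∑ j ∈ Finset.range (n + 1), (w * (y : ℂ)) ^ j / j.factorial)
            (∑ j ∈ Finset.range (n + 1),
              (j * (w * (y : ℂ)) ^ (j - 1) * w) / j.factorial) y :=
          HasDerivAt.fun_sum fun j _ => (hlin.pow j).div_const _
        refine (hlin.cexp.sub hsum).congr_deriv ?_
        symm
        rw [Finset.sum_range_succ', mul_sub, Finset.mul_sum]
        simp only [Nat.cast_zero, zero_mul, zero_div, add_zero, Nat.add_sub_cancel]
        congr 1
        · ring
        · refine Finset.sum_congr rfl fun j _ => ?_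
          have h1 : (j.factorial : ℂ) ≠ 0 := by exact_mod_cast j.factorial_ne_zero
          have h2 : ((j + 1 : ℕ) : ℂ) ≠ 0 := by exact_mod_cast j.succ_ne_zero
          rw [Nat.factorial_succ, Nat.cast_mul]
          field_simp
      have hB : ∀ y : ℝ, HasDerivAt (fun y : ℝ => y ^ (n + 1) / ((n + 1).factorial : ℝ))
          (y ^ n / n.factorial) y := by
        intro y
        refine ((hasDerivAt_pow (n + 1) y).div_const _).congr_deriv ?_
        have h1 : (n.factorial : ℝ) ≠ 0 := by exact_mod_cast n.factorial_ne_zero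
        have h2 : ((n + 1 : ℕ) : ℝ) ≠ 0 := by exact_mod_cast n.succ_ne_zero
        rw [Nat.factorial_succ, Nat.cast_mul, Nat.add_sub_cancel]
        field_simp
      refine image_norm_le_of_norm_deriv_right_le_deriv_boundary (a := 0) (b := x)
        (fun y _ => (hd y).continuousAt.continuousWithinAt)
        (fun y _ => (hd y).hasDerivWithinAt) ?_ hB ?_ ⟨hx, le_rfl⟩
      · simp [Finset.sum_range_succ']
      · intro y hy
        rw [norm_mul, hw, one_mul]
        exact ih y hy.1 w hw hre
  rcases le_total 0 x with hx | hx
  · simpa [abs_of_nonneg hx] using nonneg_case n x hx Complex.I (by simp) (by simp)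
  · simpa [abs_of_nonpos hx] using
      nonneg_case n (-x) (by linarith) (-Complex.I) (by simp) (by simp)

lemma Gamma_half_succ_sq_le (l : ℕ) :
    Real.Gamma ((l + 1) / 2) ^ 2 ≤ π * l.factorial / 2 ^ l := by
  induction l using Nat.twoStepInduction with
  | zero =>
    have : Real.Gamma (((0 : ℕ) + 1) / 2) = √π := by
      rw [← Real.Gamma_one_half_eq]; norm_num
    rw [this, Real.sq_sqrt Real.pi_pos.le]
    simp
  | one =>
    norm_num
    linarith [Real.pi_gt_three]
  | more l ih _ =>
    have hpos : ((l : ℝ) + 1) / 2 ≠ 0 := by positivity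
    have hrec : Real.Gamma (((l + 2 : ℕ) + 1) / 2) =
        (l + 1) / 2 * Real.Gamma ((l + 1) / 2) := by
      rw [← Real.Gamma_add_one hpos]
      push_cast
      congr 1
      ring
    rw [hrec, mul_pow]
    calc ((l + 1 : ℝ) / 2) ^ 2 * Real.Gamma ((l + 1) / 2) ^ 2
        ≤ ((l + 1 : ℝ) / 2) ^ 2 * (π * l.factorial / 2 ^ l) := by gcongr
      _ = π * ((l + 1) * (l + 1) * l.factorial) / 2 ^ (l + 2) := by
          field_simp
          ring
      _ ≤ π * ((l + 2) * (l + 1) * l.factorial) / 2 ^ (l + 2) := by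
          gcongr
          norm_num
      _ = π * (l + 2).factorial / 2 ^ (l + 2) := by
          simp only [Nat.factorial_succ]
          push_cast
          ring

lemma integrable_abs_pow_mul_exp_neg_mul_sq {b : ℝ} (hb : 0 < b) (l : ℕ) :
    Integrable fun s : ℝ => |s| ^ l * Real.exp (-b * s ^ 2) := by
  have := (integrable_rpow_mul_exp_neg_mul_sq hb
    (s := (l : ℝ)) (by linarith [Nat.cast_nonneg (α := ℝ) l])).norm
  simpa [Real.rpow_natCast, abs_mul, abs_pow] using this

/-- Absolute moments of a centred Gaussian, bounded by `√(l!)`. -/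
lemma integral_abs_pow_mul_exp_le {σ : ℝ} (hσ : 0 < σ) (l : ℕ) :
    ∫ s : ℝ, |s| ^ l * Real.exp (-(σ ^ 2 / 2) * s ^ 2) ≤
      √(2 * π) * √l.factorial / σ ^ (l + 1) := by
  have hb : 0 < σ ^ 2 / 2 := by positivity
  have hint : ∫ s : ℝ, |s| ^ l * Real.exp (-(σ ^ 2 / 2) * s ^ 2) =
      (σ ^ 2 / 2) ^ (-((l : ℝ) + 1) / 2) * Real.Gamma ((l + 1) / 2) := by
    have h1 := integral_comp_abs
      (f := fun s : ℝ => s ^ (l : ℝ) * Real.exp (-(σ ^ 2 / 2) * s ^ (2 : ℝ)))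
    rw [integral_rpow_mul_exp_neg_mul_rpow two_pos
      (by linarith [Nat.cast_nonneg (α := ℝ) l]) hb] at h1
    simp only [Real.rpow_natCast, Real.rpow_ofNat, sq_abs] at h1
    rw [h1]
    ring
  rw [hint]
  refine abs_le_of_sq_le_sq' ?_ (by positivity) |>.2
  have hpow : ((σ ^ 2 / 2) ^ (-((l : ℝ) + 1) / 2)) ^ 2 = 2 ^ (l + 1) / (σ ^ (l + 1)) ^ 2 := by
    rw [← Real.rpow_natCast, ← Real.rpow_mul hb.le]
    have : -((l : ℝ) + 1) / 2 * (2 : ℕ) = -((l + 1 : ℕ) : ℝ) := by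
      push_cast
      ring
    rw [this, Real.rpow_neg hb.le, Real.rpow_natCast, div_pow, inv_div, ← pow_mul, ← pow_mul,
      mul_comm 2]
  rw [mul_pow, hpow, div_pow, mul_pow, Real.sq_sqrt (by positivity), Real.sq_sqrt (by positivity)]
  calc 2 ^ (l + 1) / (σ ^ (l + 1)) ^ 2 * Real.Gamma ((l + 1) / 2) ^ 2
      ≤ 2 ^ (l + 1) / (σ ^ (l + 1)) ^ 2 * (π * l.factorial / 2 ^ l) := by
        gcongr
        exact Gamma_half_succ_sq_le l
    _ = 2 * π * l.factorial / (σ ^ (l + 1)) ^ 2 := by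
        field_simp
        ring

lemma exp_neg_sq_div_eq_integral {σ : ℝ} (hσ : 0 < σ) (x : ℝ) :
    (Real.exp (-x ^ 2 / (2 * σ ^ 2)) : ℂ) = (σ / √(2 * π) : ℝ) *
      ∫ s : ℝ, Complex.exp (Complex.I * x * s) * Real.exp (-(σ ^ 2 / 2) * s ^ 2) := by
  have hb : 0 < ((σ ^ 2 / 2 : ℝ) : ℂ).re := by
    rw [Complex.ofReal_re]
    positivity
  have key := fourierIntegral_gaussian hb (x : ℂ)
  have hroot : ((π : ℂ) / ((σ ^ 2 / 2 : ℝ) : ℂ)) ^ (1 / 2 : ℂ) = (√(2 * π) / σ : ℝ) := by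
    rw [← Complex.ofReal_div, show (1 / 2 : ℂ) = ((1 / 2 : ℝ) : ℂ) by push_cast; rfl,
      ← Complex.ofReal_cpow (by positivity), ← Real.sqrt_eq_rpow,
      show π / (σ ^ 2 / 2) = 2 * π / σ ^ 2 by field_simp, Real.sqrt_div (by positivity),
      Real.sqrt_sq hσ.le]
  have hint : ∫ s : ℝ, Complex.exp (Complex.I * x * s) * Real.exp (-(σ ^ 2 / 2) * s ^ 2) =
      (√(2 * π) / σ : ℝ) * (Real.exp (-x ^ 2 / (2 * σ ^ 2)) : ℂ) := by
    rw [hroot] at key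
    push_cast at key ⊢
    rw [key]
    congr 2
    field_simp
    ring
  have hne : √(2 * π) ≠ 0 := by positivity
  rw [hint, ← mul_assoc, ← Complex.ofReal_mul]
  field_simp
  simp

/-- Taylor approximation of an unnormalised Gaussian, with an explicit remainder. -/
lemma exists_coeff_gaussian_taylor {σ : ℝ} (hσ : 0 < σ) (l : ℕ) (x : ℝ) :
    ∃ c : ℕ → ℝ, c 0 = Real.exp (-x ^ 2 / (2 * σ ^ 2)) ∧ ∀ y : ℝ,
      |Real.exp (-(x + y) ^ 2 / (2 * σ ^ 2)) - ∑ j ∈ Finset.range l, c j * y ^ j| ≤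
        |y| ^ l / (√l.factorial * σ ^ l) := by
  have hb : 0 < σ ^ 2 / 2 := by positivity
  set F : ℕ → ℝ → ℂ := fun j s => (Complex.I * s) ^ j / j.factorial *
    (Complex.exp (Complex.I * x * s) * Real.exp (-(σ ^ 2 / 2) * s ^ 2)) with hF
  have hexp (z s : ℝ) : ‖Complex.exp (Complex.I * z * s)‖ = 1 := by
    rw [mul_assoc, ← Complex.ofReal_mul, Complex.norm_exp_I_mul_ofReal]
  have hFint (j : ℕ) : Integrable (F j) := by
    refine ((integrable_abs_pow_mul_exp_neg_mul_sq hb j).div_const (j.factorial : ℝ)).mono'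
      (by rw [hF]; fun_prop) (Filter.Eventually.of_forall fun s => le_of_eq ?_)
    simp only [hF, norm_mul, norm_div, norm_pow, Complex.norm_I, Complex.norm_real, hexp,
      Complex.norm_natCast, Real.norm_eq_abs, Real.abs_exp, one_mul]
    ring
  have hEint (z : ℝ) : Integrable fun s : ℝ =>
      Complex.exp (Complex.I * z * s) * Real.exp (-(σ ^ 2 / 2) * s ^ 2) := by
    refine (integrable_exp_neg_mul_sq hb).mono' (by fun_prop)
      (Filter.Eventually.of_forall fun s => le_of_eq ?_)
    simp only [norm_mul, hexp, Complex.norm_real, Real.norm_eq_abs, Real.abs_exp, one_mul]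
  refine ⟨fun j => ((σ / √(2 * π) : ℝ) * ∫ s, F j s).re, ?_, fun y => ?_⟩
  · have h0 := exp_neg_sq_div_eq_integral hσ x
    simp only [hF, pow_zero, Nat.factorial_zero, Nat.cast_one, div_one, one_mul]
    rw [← h0, Complex.ofReal_re]
  · have hdiff : ((Real.exp (-(x + y) ^ 2 / (2 * σ ^ 2)) : ℝ) : ℂ) -
        ∑ j ∈ Finset.range l, ((σ / √(2 * π) : ℝ) * ∫ s, F j s) * ((y ^ j : ℝ) : ℂ) =
        (σ / √(2 * π) : ℝ) * ∫ s : ℝ,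
          (Complex.exp (Complex.I * (y * s : ℝ)) -
            ∑ j ∈ Finset.range l, (Complex.I * (y * s : ℝ)) ^ j / j.factorial) *
          (Complex.exp (Complex.I * x * s) * Real.exp (-(σ ^ 2 / 2) * s ^ 2)) := by
      have hsum : ∑ j ∈ Finset.range l, (∫ s, F j s) * ((y ^ j : ℝ) : ℂ) =
          ∫ s, ∑ j ∈ Finset.range l, F j s * ((y ^ j : ℝ) : ℂ) := by
        rw [integral_finsetSum _ fun j _ => (hFint j).mul_const _]
        simp only [integral_mul_const]
      simp only [mul_assoc ((σ / √(2 * π) : ℝ) : ℂ)]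
      rw [exp_neg_sq_div_eq_integral hσ (x + y), ← Finset.mul_sum, hsum, ← mul_sub,
        ← integral_sub (hEint _) (integrable_finsetSum _ fun j _ => (hFint j).mul_const _)]
      congr 2
      funext s
      rw [sub_mul, Finset.sum_mul, ← mul_assoc, ← Complex.exp_add]
      congr 1
      · congr 2
        push_cast
        ring
      · refine Finset.sum_congr rfl fun j _ => ?_
        simp only [hF]
        push_cast
        ring
    have hre : Real.exp (-(x + y) ^ 2 / (2 * σ ^ 2)) -
        ∑ j ∈ Finset.range l, ((σ / √(2 * π) : ℝ) * ∫ s, F j s).re * y ^ j =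
        (((Real.exp (-(x + y) ^ 2 / (2 * σ ^ 2)) : ℝ) : ℂ) -
        ∑ j ∈ Finset.range l, ((σ / √(2 * π) : ℝ) * ∫ s, F j s) * ((y ^ j : ℝ) : ℂ)).re := by
      rw [Complex.sub_re, Complex.ofReal_re, Complex.re_sum]
      simp only [Complex.re_mul_ofReal]
    rw [hre, hdiff]
    refine (Complex.abs_re_le_norm _).trans ?_
    rw [norm_mul, Complex.norm_real, Real.norm_of_nonneg (by positivity)]
    calc _ ≤ σ / √(2 * π) * ∫ s : ℝ, |y| ^ l / l.factorial *
          (|s| ^ l * Real.exp (-(σ ^ 2 / 2) * s ^ 2)) := by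
          gcongr
          refine norm_integral_le_of_norm_le
            ((integrable_abs_pow_mul_exp_neg_mul_sq hb l).const_mul _)
            (Filter.Eventually.of_forall fun s => ?_)
          rw [norm_mul, norm_mul, hexp, one_mul, Complex.norm_real, Real.norm_eq_abs,
            Real.abs_exp]
          refine (mul_le_mul_of_nonneg_right (norm_exp_I_mul_sub_sum_le l (y * s))
            (Real.exp_pos _).le).trans (le_of_eq ?_)
          rw [abs_mul, mul_pow]
          ring
      _ ≤ σ / √(2 * π) * (|y| ^ l / l.factorial *
          (√(2 * π) * √l.factorial / σ ^ (l + 1))) := by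
          rw [integral_const_mul]
          gcongr
          exact integral_abs_pow_mul_exp_le hσ l
      _ = |y| ^ l / (√l.factorial * σ ^ l) := by
          have h1 : √(2 * π) ≠ 0 := by positivity
          have h2 : √(l.factorial : ℝ) ≠ 0 := by positivity
          have h3 : (l.factorial : ℝ) = √l.factorial ^ 2 := (Real.sq_sqrt (by positivity)).symm
          nth_rewrite 1 [h3]
          field_simp
          ring

/-- A kernel of order `l` supported on `[-1, 1]` only sees the error of a polynomial
approximation of degree less than `l`. -/
lemma abs_integral_kernel_mul_sub_le {K : ℝ → ℝ} {Ksup M : ℝ} {l : ℕ} (hl : 1 ≤ l)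
    (hKmeas : Measurable K) (hKsup : ∀ u, |K u| ≤ Ksup)
    (hKsupp : ∀ u, u ∉ Set.Icc (-1 : ℝ) 1 → K u = 0) (hKint : ∫ u, K u = 1)
    (hKmom : ∀ j : ℕ, 1 ≤ j → j ≤ l → ∫ u, u ^ j * K u = 0)
    {g : ℝ → ℝ} (hg : Continuous g) (c : ℕ → ℝ)
    (hgc : ∀ u ∈ Set.Icc (-1 : ℝ) 1, |g u - ∑ j ∈ Finset.range l, c j * u ^ j| ≤ M) :
    |(∫ u, K u * g u) - c 0| ≤ 2 * Ksup * M := by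
  have hKon : IntegrableOn K (Set.Icc (-1) 1) :=
    Measure.integrableOn_of_bounded (M := Ksup) (by simp) hKmeas.aestronglyMeasurable
      (Filter.Eventually.of_forall hKsup)
  have hint {p : ℝ → ℝ} (hp : Continuous p) : Integrable fun u => K u * p u := by
    have := hKon.mul_continuousOn hp.continuousOn isCompact_Icc
    refine this.integrable_of_forall_notMem_eq_zero fun u hu => ?_
    simp [hKsupp u hu]
  have hpoly : ∫ u, K u * ∑ j ∈ Finset.range l, c j * u ^ j = c 0 := by
    simp only [Finset.mul_sum]
    rw [integral_finsetSum _ fun j _ => hint (by fun_prop),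
      Finset.sum_eq_single_of_mem 0 (Finset.mem_range.mpr hl)]
    · simp [integral_mul_const, hKint]
    · intro j hj hj0
      have : (fun u => K u * (c j * u ^ j)) = fun u => c j * (u ^ j * K u) := by
        funext u
        ring
      rw [this, integral_const_mul,
        hKmom j (Nat.one_le_iff_ne_zero.mpr hj0) (Finset.mem_range.mp hj).le, mul_zero]
  have hsub : (∫ u, K u * g u) - c 0 =
      ∫ u in Set.Icc (-1 : ℝ) 1, K u * (g u - ∑ j ∈ Finset.range l, c j * u ^ j) := by
    rw [setIntegral_eq_integral_of_forall_compl_eq_zero fun u hu => by simp [hKsupp u hu]]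
    simp only [mul_sub]
    rw [integral_sub (hint hg) (hint (by fun_prop)), hpoly]
  rw [hsub, ← Real.norm_eq_abs]
  have hK0 : 0 ≤ Ksup := (abs_nonneg _).trans (hKsup 0)
  refine (norm_setIntegral_le_of_norm_le_const (C := Ksup * M) (by simp) fun u hu => ?_).trans
    (le_of_eq ?_)
  · rw [norm_mul]
    exact mul_le_mul (hKsup u) (hgc u hu) (abs_nonneg _) hK0
  · simp [Measure.real]
    norm_num
    ring

/-- **Gaussian densities are super-smooth** (kernel bias bound).
For a Gaussian density with standard deviation `σ ≥ σ₀` and a kernel `K` of order `l`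
supported on `[-1,1]`, the bias of the kernel density estimator is bounded by
`(1.09 ‖K‖_∞ / (√(π/2) √(l!) σ₀^{l+1})) hˡ`. -/
theorem gaussian_kernel_bias_bound
    (σ₀ σ μ : ℝ) (hσ₀ : 0 < σ₀) (hσ : σ₀ ≤ σ)
    (f : ℝ → ℝ)
    (hf : ∀ z, f z = (Real.sqrt (2 * Real.pi * σ ^ 2))⁻¹ *
        Real.exp (-(z - μ) ^ 2 / (2 * σ ^ 2)))
    (l : ℕ) (hl : 1 ≤ l)
    (K : ℝ → ℝ) (hKmeas : Measurable K)
    (Ksup : ℝ) (hKsup : ∀ u, |K u| ≤ Ksup)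
    (hKsupp : ∀ u, u ∉ Set.Icc (-1 : ℝ) 1 → K u = 0)
    (hKint : ∫ u, K u = 1)
    (hKmom : ∀ j : ℕ, 1 ≤ j → j ≤ l → ∫ u, u ^ j * K u = 0)
    (t h : ℝ) (hh : 0 < h) :
    |(∫ z, (1 / h) * K ((z - t) / h) * f z) - f t| ≤
      1.09 * Ksup / (Real.sqrt (Real.pi / 2) * Real.sqrt (Nat.factorial l) * σ₀ ^ (l + 1))
        * h ^ l := by
  have hσpos : 0 < σ := hσ₀.trans_le hσ
  have hK0 : 0 ≤ Ksup := (abs_nonneg _).trans (hKsup 0)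
  obtain ⟨c, hc0, hc⟩ := exists_coeff_gaussian_taylor hσpos l (t - μ)
  set A := (Real.sqrt (2 * Real.pi * σ ^ 2))⁻¹ with hA
  have hA0 : 0 ≤ A := by positivity
  have hAeq : A = 1 / (√(2 * π) * σ) := by
    rw [hA, Real.sqrt_mul (by positivity), Real.sqrt_sq hσpos.le, one_div]
  have hchange : ∫ z, (1 / h) * K ((z - t) / h) * f z = ∫ u, K u * f (t + h * u) := by
    have h1 := integral_sub_right_eq_self
      (fun z => (1 / h) * K (z / h) * f (t + h * (z / h))) t (μ := volume)
    have h2 := Measure.integral_comp_div (fun u => (1 / h) * K u * f (t + h * u)) h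
    have hscale : |h| • ∫ u, (1 / h) * K u * f (t + h * u) = ∫ u, K u * f (t + h * u) := by
      simp only [mul_assoc (1 / h), integral_const_mul]
      rw [smul_eq_mul, abs_of_pos hh, ← mul_assoc, mul_one_div_cancel hh.ne', one_mul]
    rw [← hscale, ← h2, ← h1]
    congr 1
    funext z
    rw [mul_div_cancel₀ _ hh.ne', add_sub_cancel]
  have hbias := abs_integral_kernel_mul_sub_le (M := A * (h ^ l / (√l.factorial * σ ^ l)))
    hl hKmeas hKsup hKsupp hKint hKmom (g := fun u => f (t + h * u))
    (by simp only [hf]; fun_prop) (fun j => A * (c j * h ^ j)) (fun u hu => by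
      have hrem := hc (h * u)
      have heq : f (t + h * u) - ∑ j ∈ Finset.range l, A * (c j * h ^ j) * u ^ j =
          A * (Real.exp (-(t - μ + h * u) ^ 2 / (2 * σ ^ 2)) -
            ∑ j ∈ Finset.range l, c j * (h * u) ^ j) := by
        rw [hf, mul_sub, Finset.mul_sum]
        congr 1
        · congr 4
          ring
        · exact Finset.sum_congr rfl fun j _ => by ring
      rw [heq, abs_mul, abs_of_nonneg hA0]
      refine mul_le_mul_of_nonneg_left (hrem.trans ?_) hA0
      gcongr
      rw [abs_mul, abs_of_pos hh]
      exact mul_le_of_le_one_right hh.le (abs_le.mpr hu))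
  rw [hchange, show f t = A * (c 0 * h ^ 0) by rw [hf, hc0, pow_zero, mul_one]]
  refine hbias.trans ?_
  have hroot : √(2 * π) = 2 * √(π / 2) := by
    rw [show 2 * π = 2 ^ 2 * (π / 2) by ring, Real.sqrt_mul (by norm_num),
      Real.sqrt_sq (by norm_num)]
  calc 2 * Ksup * (A * (h ^ l / (√l.factorial * σ ^ l)))
      = 1 * Ksup / (√(π / 2) * √l.factorial * σ ^ (l + 1)) * h ^ l := by
        rw [hAeq, hroot]
        field_simp
        ring
    _ ≤ _ := by
        gcongr
        norm_num
end

section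
/- Let Φ and φ denote the standard normal distribution function and density. For every μ > 0 and every t ≤ min{−1, −μ}, one has Φ(t)/Φ(t−μ) ≤ 5 e^{μ²/2} e^{−μ t}, equivalently Φ(t) ≤ 5 e^{μ²/2 − μ t} Φ(t − μ). -/
open Real

/-- The standard normal density. -/
noncomputable def stdNormalPDF (t : ℝ) : ℝ :=
  (Real.sqrt (2 * Real.pi))⁻¹ * Real.exp (-(t ^ 2) / 2)

/-- The standard normal distribution function. -/
noncomputable def stdNormalCDF (t : ℝ) : ℝ :=
  ∫ x in Set.Iic t, stdNormalPDF x

open MeasureTheory in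
lemma integrable_stdNormalPDF : Integrable stdNormalPDF := by
  refine ((integrable_exp_neg_mul_sq (b := 1 / 2) (by norm_num)).const_mul
    (Real.sqrt (2 * Real.pi))⁻¹).congr (ae_of_all _ fun x => ?_)
  simp only [stdNormalPDF]
  ring_nf

open MeasureTheory in
lemma integrable_neg_mul_stdNormalPDF : Integrable fun x => -x * stdNormalPDF x := by
  refine ((integrable_mul_exp_neg_mul_sq (b := 1 / 2) (by norm_num)).const_mul
    (-(Real.sqrt (2 * Real.pi))⁻¹)).congr (ae_of_all _ fun x => ?_)
  simp only [stdNormalPDF]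
  ring_nf

lemma stdNormalPDF_pos (x : ℝ) : 0 < stdNormalPDF x := by
  unfold stdNormalPDF
  positivity

lemma hasDerivAt_stdNormalPDF (x : ℝ) :
    HasDerivAt stdNormalPDF (-x * stdNormalPDF x) x := by
  have h : HasDerivAt (fun y : ℝ => -(y ^ 2) / 2) (-x) x := by
    refine ((hasDerivAt_pow 2 x).neg.div_const 2).congr_deriv ?_
    norm_num
    ring
  refine (h.exp.const_mul (Real.sqrt (2 * Real.pi))⁻¹).congr_deriv ?_
  simp only [stdNormalPDF]
  ring

open MeasureTheory Set Filter Topology in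
lemma tendsto_stdNormalPDF_atBot : Tendsto stdNormalPDF atBot (𝓝 0) :=
  tendsto_zero_of_hasDerivAt_of_integrableOn_Iic (a := 0)
    (fun x _ => hasDerivAt_stdNormalPDF x)
    integrable_neg_mul_stdNormalPDF.integrableOn integrable_stdNormalPDF.integrableOn

open MeasureTheory Set in
/-- Upper Mills ratio bound for the lower tail of the standard normal distribution. -/
lemma neg_mul_stdNormalCDF_le (t : ℝ) : -t * stdNormalCDF t ≤ stdNormalPDF t := by
  have h : ∫ x in Iic t, -x * stdNormalPDF x = stdNormalPDF t - 0 :=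
    integral_Iic_of_hasDerivAt_of_tendsto' (fun x _ => hasDerivAt_stdNormalPDF x)
      integrable_neg_mul_stdNormalPDF.integrableOn tendsto_stdNormalPDF_atBot
  rw [sub_zero] at h
  rw [← h, stdNormalCDF, ← integral_const_mul]
  refine setIntegral_mono_on (integrable_stdNormalPDF.const_mul _).integrableOn
    integrable_neg_mul_stdNormalPDF.integrableOn measurableSet_Iic fun x hx => ?_
  exact mul_le_mul_of_nonneg_right (neg_le_neg hx) (stdNormalPDF_pos x).le

open MeasureTheory Set Filter Topology in
/-- Lower Mills ratio bound for the lower tail of the standard normal distribution. -/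
lemma neg_mul_stdNormalPDF_le {t : ℝ} (ht : t < 0) :
    -t * stdNormalPDF t ≤ (1 + t ^ 2) * stdNormalCDF t := by
  have hderiv : ∀ x ∈ Iic t, HasDerivAt (fun y => -(stdNormalPDF y * y⁻¹))
      ((1 + (x ^ 2)⁻¹) * stdNormalPDF x) x := by
    intro x hx
    have hx0 : x ≠ 0 := (lt_of_le_of_lt hx ht).ne
    refine ((hasDerivAt_stdNormalPDF x).mul (hasDerivAt_inv hx0)).neg.congr_deriv ?_
    field_simp
    ring
  have hle : ∀ x ∈ Iic t, (1 + (x ^ 2)⁻¹) * stdNormalPDF x ≤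
      (1 + (t ^ 2)⁻¹) * stdNormalPDF x := by
    intro x hx
    have hx' : x ≤ t := hx
    have hsq : t ^ 2 ≤ x ^ 2 := by nlinarith
    have ht2 : 0 < t ^ 2 := by nlinarith
    have := stdNormalPDF_pos x
    gcongr
  have hdom : IntegrableOn (fun x => (1 + (t ^ 2)⁻¹) * stdNormalPDF x) (Iic t) :=
    (integrable_stdNormalPDF.const_mul _).integrableOn
  have hint : IntegrableOn (fun x => (1 + (x ^ 2)⁻¹) * stdNormalPDF x) (Iic t) := by
    refine Integrable.mono' hdom ?_ ((ae_restrict_mem measurableSet_Iic).mono fun x hx => ?_)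
    · refine Measurable.aestronglyMeasurable ?_
      unfold stdNormalPDF
      fun_prop
    · have := stdNormalPDF_pos x
      rw [Real.norm_of_nonneg (by positivity)]
      exact hle x hx
  have hlim : Tendsto (fun y => -(stdNormalPDF y * y⁻¹)) atBot (𝓝 0) := by
    simpa using (tendsto_stdNormalPDF_atBot.mul tendsto_inv_atBot_zero).neg
  have h := integral_Iic_of_hasDerivAt_of_tendsto' hderiv hint hlim
  have hmono := setIntegral_mono_on hint hdom measurableSet_Iic hle
  rw [h, integral_const_mul, sub_zero] at hmono
  change _ ≤ _ * stdNormalCDF t at hmono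
  have ht0 : t ≠ 0 := ht.ne
  calc -t * stdNormalPDF t = t ^ 2 * -(stdNormalPDF t * t⁻¹) := by field_simp
    _ ≤ t ^ 2 * ((1 + (t ^ 2)⁻¹) * stdNormalCDF t) :=
      mul_le_mul_of_nonneg_left hmono (sq_nonneg t)
    _ = (1 + t ^ 2) * stdNormalCDF t := by field_simp; ring

lemma stdNormalCDF_pos_of_neg {t : ℝ} (ht : t < 0) : 0 < stdNormalCDF t := by
  have h := neg_mul_stdNormalPDF_le ht
  have hp : 0 < -t * stdNormalPDF t := mul_pos (neg_pos.2 ht) (stdNormalPDF_pos t)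
  exact pos_of_mul_pos_right (hp.trans_le h) (by positivity)

lemma stdNormalPDF_eq_exp_mul (μ t : ℝ) :
    stdNormalPDF t = Real.exp (μ ^ 2 / 2 - μ * t) * stdNormalPDF (t - μ) := by
  unfold stdNormalPDF
  rw [mul_left_comm, ← Real.exp_add]
  ring_nf

/-- **Lower-tail ratio bound for shifted normal distribution functions.**
For `μ > 0` and `t ≤ min{-1, -μ}`, `Φ(t)/Φ(t-μ) ≤ 5 e^{μ²/2} e^{-μt}`, equivalently
`Φ(t) ≤ 5 e^{μ²/2 - μt} Φ(t-μ)`. -/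
theorem shifted_normal_lower_tail_ratio
    (μ t : ℝ) (hμ : 0 < μ) (ht : t ≤ min (-1) (-μ)) :
    stdNormalCDF t / stdNormalCDF (t - μ) ≤
        5 * Real.exp (μ ^ 2 / 2) * Real.exp (-μ * t) ∧
    stdNormalCDF t ≤
        5 * Real.exp (μ ^ 2 / 2 - μ * t) * stdNormalCDF (t - μ) := by
  obtain ⟨ht1, htμ⟩ := le_min_iff.1 ht
  have hs : t - μ < 0 := by linarith
  have hpos := stdNormalCDF_pos_of_neg hs
  have hpdf : stdNormalPDF (t - μ) ≤ -t * (5 * stdNormalCDF (t - μ)) := by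
    have hlow := neg_mul_stdNormalPDF_le hs
    have hcoef : 1 + (t - μ) ^ 2 ≤ -(t - μ) * (-t * 5) := by nlinarith
    have := mul_le_mul_of_nonneg_right hcoef hpos.le
    refine le_of_mul_le_mul_left (a := -(t - μ)) ?_ (by linarith)
    linarith
  have hmain : stdNormalCDF t ≤
      5 * Real.exp (μ ^ 2 / 2 - μ * t) * stdNormalCDF (t - μ) := by
    have hup := neg_mul_stdNormalCDF_le t
    rw [stdNormalPDF_eq_exp_mul μ t] at hup
    have := mul_le_mul_of_nonneg_left hpdf (Real.exp_pos (μ ^ 2 / 2 - μ * t)).le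
    refine le_of_mul_le_mul_left (a := -t) ?_ (by linarith)
    linarith
  refine ⟨?_, hmain⟩
  rw [div_le_iff₀ hpos, mul_assoc 5, ← Real.exp_add, neg_mul, ← sub_eq_add_neg]
  exact hmain
end

section
/- Let μ⁰ and μ¹ be probability measures on ℝ^d with everywhere positive densities f⁰ and f¹ with respect to Lebesgue measure, representing the class-conditional distributions of X given Y = 0 and Y = 1 under equal class priors ℙ(Y=0) = ℙ(Y=1) = 1/2. For a measurable classifier δ : ℝ^d → {0,1} define its risk R(δ) = (1/2) μ⁰({x : δ(x) = 1}) + (1/2) μ¹({x : δ(x) = 0}). Let g(x) = log(f⁰(x)/f¹(x)), let the Bayes classifier be δ*(x) = 1 iff g(x) ≤ 0, let ĝ : ℝ^d → ℝ be any measurable function and δ̂(x) = 1 iff ĝ(x) ≤ 0. Then the excess risk satisfies R(δ̂) − R(δ*) ≤ (1/2) ∫ |g(x)| · 1{ |ĝ(x) − g(x)| ≥ |g(x)| } dP_X(x), where P_X = (μ⁰ + μ¹)/2 is the marginal distribution of X. -/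
open Real MeasureTheory
open scoped ENNReal

/-- `|a - b| ≤ |log (a / b)| (a + b) / 2`, i.e. `tanh (t / 2) ≤ t / 2`. -/
theorem abs_sub_le_abs_log_div_mul {a b : ℝ} (ha : 0 < a) (hb : 0 < b) :
    |a - b| ≤ |Real.log (a / b)| * ((a + b) / 2) := by
  wlog h : b ≤ a generalizing a b
  · have := this hb ha (le_of_not_ge h)
    rwa [abs_sub_comm, add_comm b a, ← inv_div a b, Real.log_inv, abs_neg] at this
  have hx : 0 ≤ (a - b) / b := div_nonneg (sub_nonneg.2 h) hb.le
  have key := Real.le_log_one_add_of_nonneg hx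
  have e1 : 1 + (a - b) / b = a / b := by field_simp; ring
  have e2 : 2 * ((a - b) / b) / ((a - b) / b + 2) = (a - b) / ((a + b) / 2) := by
    have : (a - b) / b + 2 = (a + b) / b := by field_simp; ring
    rw [this]
    field_simp
  rw [e1, e2, div_le_iff₀ (by positivity)] at key
  rw [abs_of_nonneg (sub_nonneg.2 h)]
  exact key.trans (mul_le_mul_of_nonneg_right (le_abs_self _) (by positivity))

/-- Disagreement of the signs of `u` and `v` forces `|u - v| ≥ |v|`. -/
theorem abs_le_abs_sub_of_not_iff {u v : ℝ} (h : ¬ (u ≤ 0 ↔ v ≤ 0)) : |v| ≤ |u - v| := by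
  rcases le_or_gt u 0 with hu | hu <;> rcases le_or_gt v 0 with hv | hv
  · exact absurd (iff_of_true hu hv) h
  · rw [abs_of_pos hv, abs_sub_comm]
    exact (by linarith : v ≤ v - u).trans (le_abs_self _)
  · rw [abs_of_nonpos hv]
    exact (by linarith : -v ≤ u - v).trans (le_abs_self _)
  · exact absurd (iff_of_false hu.not_ge hv.not_ge) h

theorem integrable_of_isFiniteMeasure_withDensity_ofReal {α : Type*} [MeasurableSpace α]
    {ν : Measure α} {f : α → ℝ} (hf : Measurable f) (hpos : ∀ x, 0 ≤ f x)
    [IsFiniteMeasure (ν.withDensity fun x => ENNReal.ofReal (f x))] : Integrable f ν := by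
  refine ⟨hf.aestronglyMeasurable, ?_⟩
  rw [hasFiniteIntegral_iff_ofReal (ae_of_all _ hpos)]
  have := measure_lt_top (ν.withDensity fun x => ENNReal.ofReal (f x)) Set.univ
  rwa [withDensity_apply _ MeasurableSet.univ, Measure.restrict_univ] at this

theorem toReal_withDensity_ofReal_apply {α : Type*} [MeasurableSpace α]
    {ν : Measure α} {f : α → ℝ} (hf : Measurable f) (hpos : ∀ x, 0 ≤ f x)
    {s : Set α} (hs : MeasurableSet s) :
    ((ν.withDensity fun x => ENNReal.ofReal (f x)) s).toReal = ∫ x in s, f x ∂ν := by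
  rw [withDensity_apply _ hs,
    integral_eq_lintegral_of_nonneg_ae (ae_of_all _ hpos) hf.aestronglyMeasurable]

/-- **Excess risk bound for the plug-in classifier.**
The excess risk of the plug-in rule based on an estimator `ĝ` of the log density ratio
`g` is bounded by `(1/2) ∫ |g| 1{|ĝ - g| ≥ |g|} dP_X`. -/
theorem excess_risk_integral_bound
    (d : ℕ) (hd : 1 ≤ d)
    (f0 f1 : (Fin d → ℝ) → ℝ)
    (hf0meas : Measurable f0) (hf1meas : Measurable f1)
    (hf0pos : ∀ x, 0 < f0 x) (hf1pos : ∀ x, 0 < f1 x)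
    (μ0 μ1 : Measure (Fin d → ℝ))
    (hμ0 : μ0 = MeasureTheory.volume.withDensity (fun x => ENNReal.ofReal (f0 x)))
    (hμ1 : μ1 = MeasureTheory.volume.withDensity (fun x => ENNReal.ofReal (f1 x)))
    (hp0 : IsProbabilityMeasure μ0) (hp1 : IsProbabilityMeasure μ1)
    (PX : Measure (Fin d → ℝ))
    (hPX : PX = (1 / 2 : ℝ≥0∞) • (μ0 + μ1))
    (g ghat : (Fin d → ℝ) → ℝ)
    (hg : ∀ x, g x = Real.log (f0 x / f1 x))
    (hghat : Measurable ghat)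
    (R : ((Fin d → ℝ) → Prop) → ℝ)
    (hR : ∀ δ : (Fin d → ℝ) → Prop,
      R δ = (1 / 2) * (μ0 {x | δ x}).toReal + (1 / 2) * (μ1 {x | ¬ δ x}).toReal) :
    ENNReal.ofReal (R (fun x => ghat x ≤ 0) - R (fun x => g x ≤ 0)) ≤
      (1 / 2 : ℝ≥0∞) *
        ∫⁻ x in {x | |g x| ≤ |ghat x - g x|}, ENNReal.ofReal |g x| ∂PX := by
  have hgm : Measurable g := by
    rw [show g = fun x => Real.log (f0 x / f1 x) from funext hg]
    exact (hf0meas.div hf1meas).log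
  have hA : MeasurableSet {x | ghat x ≤ 0} := measurableSet_le hghat measurable_const
  have hB : MeasurableSet {x | g x ≤ 0} := measurableSet_le hgm measurable_const
  have hD : MeasurableSet {x | |g x| ≤ |ghat x - g x|} :=
    measurableSet_le hgm.abs (hghat.sub hgm).abs
  subst hμ0 hμ1
  have hi0 : Integrable f0 volume :=
    integrable_of_isFiniteMeasure_withDensity_ofReal hf0meas fun x => (hf0pos x).le
  have hi1 : Integrable f1 volume :=
    integrable_of_isFiniteMeasure_withDensity_ofReal hf1meas fun x => (hf1pos x).le
  have hi : Integrable (fun x => f0 x - f1 x) volume := hi0.sub hi1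
  have hRisk : ∀ δ : (Fin d → ℝ) → Prop, MeasurableSet {x | δ x} →
      R δ = (1 / 2) * (∫ x, {x | δ x}.indicator (fun x => f0 x - f1 x) x) + 1 / 2 := by
    intro δ hδ
    have hc : (volume.withDensity fun x => ENNReal.ofReal (f1 x)) {x | ¬ δ x}
        = 1 - (volume.withDensity fun x => ENNReal.ofReal (f1 x)) {x | δ x} :=
      prob_compl_eq_one_sub hδ
    rw [hR, hc, ENNReal.toReal_sub_of_le prob_le_one ENNReal.one_ne_top, ENNReal.toReal_one,
      toReal_withDensity_ofReal_apply hf0meas (fun x => (hf0pos x).le) hδ,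
      toReal_withDensity_ofReal_apply hf1meas (fun x => (hf1pos x).le) hδ,
      integral_indicator hδ, integral_sub hi0.integrableOn hi1.integrableOn]
    ring
  set D := {x | |g x| ≤ |ghat x - g x|}
  have hle : R (fun x => ghat x ≤ 0) - R (fun x => g x ≤ 0) ≤
      (1 / 2) * ∫ x in D, |f0 x - f1 x| := by
    rw [hRisk _ hA, hRisk _ hB, add_sub_add_right_eq_sub, ← mul_sub,
      ← integral_sub (hi.indicator hA) (hi.indicator hB), ← integral_indicator hD]
    refine mul_le_mul_of_nonneg_left (integral_mono ((hi.indicator hA).sub (hi.indicator hB))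
      (hi.abs.indicator hD) fun x => ?_) (by norm_num)
    by_cases hx : ghat x ≤ 0 ↔ g x ≤ 0
    · have h0 : (0 : ℝ) ≤ D.indicator (fun x => |f0 x - f1 x|) x :=
        Set.indicator_nonneg (fun _ _ => abs_nonneg _) x
      by_cases hgx : g x ≤ 0 <;> simpa [Set.indicator, hx, hgx] using h0
    · have hxD : x ∈ D := abs_le_abs_sub_of_not_iff hx
      rw [Set.indicator_of_mem hxD]
      by_cases hgx : g x ≤ 0 <;> by_cases hgh : ghat x ≤ 0
      · exact absurd (iff_of_true hgh hgx) hx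
      · simpa [Set.indicator, hgx, hgh] using neg_le_abs (f0 x - f1 x)
      · simpa [Set.indicator, hgx, hgh] using le_abs_self (f0 x - f1 x)
      · exact absurd (iff_of_false hgh hgx) hx
  have hPXint : ∫⁻ x in D, ENNReal.ofReal |g x| ∂PX =
      ∫⁻ x in D, ENNReal.ofReal (|g x| * ((f0 x + f1 x) / 2)) := by
    have hm : Measurable fun x => ENNReal.ofReal |g x| := hgm.abs.ennreal_ofReal
    rw [hPX, Measure.restrict_smul, lintegral_smul_measure, Measure.restrict_add,
      lintegral_add_measure,
      setLIntegral_withDensity_eq_setLIntegral_mul _ hf0meas.ennreal_ofReal hm hD,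
      setLIntegral_withDensity_eq_setLIntegral_mul _ hf1meas.ennreal_ofReal hm hD,
      ← lintegral_add_left (hf0meas.ennreal_ofReal.mul hm), smul_eq_mul,
      ← lintegral_const_mul' _ _ (by simp)]
    refine lintegral_congr fun x => ?_
    have h0 := (hf0pos x).le
    have h1 := (hf1pos x).le
    have hhalf : (1 / 2 : ℝ≥0∞) = ENNReal.ofReal (1 / 2) := by
      rw [ENNReal.ofReal_div_of_pos two_pos]; simp
    simp only [Pi.mul_apply]
    rw [← add_mul, ← ENNReal.ofReal_add h0 h1, ← ENNReal.ofReal_mul (add_nonneg h0 h1), hhalf,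
      ← ENNReal.ofReal_mul (by norm_num)]
    congr 1
    ring
  refine (ENNReal.ofReal_le_ofReal hle).trans ?_
  rw [hPXint, ENNReal.ofReal_mul (by norm_num), ofReal_integral_eq_lintegral_ofReal
    hi.abs.integrableOn (ae_of_all _ fun x => abs_nonneg _)]
  refine mul_le_mul' ?_ (lintegral_mono fun x => ENNReal.ofReal_le_ofReal ?_)
  · rw [ENNReal.ofReal_div_of_pos two_pos]; simp
  · rw [hg]
    exact abs_sub_le_abs_log_div_mul (hf0pos x) (hf1pos x)
end

section
/- Let d ≥ 1, let Ω and Ω̂ be real d×d matrices, and let r ≥ 0 and τ ≥ r. Suppose ‖Ω̂ − Ω‖_∞ ≤ r, where ‖A‖_∞ = max_k Σ_ℓ |A_{kℓ}| is the maximum absolute row sum. Suppose all diagonal entries of Ω are ≥ 1; for every off-diagonal pair k ≠ ℓ, either Ω_{kℓ} = 0 or |Ω_{kℓ}| > 2τ; and for every k, either Ω_{kk} = 1 or Ω_{kk} > 1 + 2τ. Define the thresholded matrix Ω̃ by: for k ≠ ℓ, Ω̃_{kℓ} = Ω̂_{kℓ} if |Ω̂_{kℓ}| > τ and Ω̃_{kℓ}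 = 0 otherwise; and Ω̃_{kk} = Ω̂_{kk} if Ω̂_{kk} > 1 + τ and Ω̃_{kk} = 1 otherwise. Then sign(Ω̃_{kℓ} − (I_d)_{kℓ}) = sign(Ω_{kℓ} − (I_d)_{kℓ}) for all k, ℓ (entrywise sign recovery of Ω − I_d), and ‖Ω̃ − Ω‖_∞ ≤ r. -/
open Real Matrix BigOperators

/-- Hard thresholding at a level `τ` that dominates the estimation error of `b` for `a` recovers
the sign of `a`, and does not increase the error, if `a` is `0` or larger than `2 * τ`. -/
theorem sign_hardThreshold_eq_and_abs_sub_le {a b t τ : ℝ} (hab : |b - a| ≤ τ)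
    (ha : a = 0 ∨ 2 * τ < |a|) (ht : t = if τ < |b| then b else 0) :
    Real.sign t = Real.sign a ∧ |t - a| ≤ |b - a| := by
  have hτ : 0 ≤ τ := (abs_nonneg _).trans hab
  rcases ha with rfl | ha
  · rw [sub_zero] at hab
    rw [ht, if_neg hab.not_gt]
    simp
  · obtain ⟨h₁, h₂⟩ := abs_le.mp hab
    rcases lt_abs.mp ha with h | h
    · rw [ht, if_pos (lt_abs.mpr (Or.inl (by linarith))),
        Real.sign_of_pos (by linarith), Real.sign_of_pos (by linarith)]
      exact ⟨rfl, le_rfl⟩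
    · rw [ht, if_pos (lt_abs.mpr (Or.inr (by linarith))),
        Real.sign_of_neg (by linarith), Real.sign_of_neg (by linarith)]
      exact ⟨rfl, le_rfl⟩

/-- **Support recovery and error bound for the thresholded precision matrix estimator.**
Thresholding an estimator `Ω̂` of a precision matrix `Ω` (off-diagonal entries toward 0,
diagonal entries toward 1) at level `τ ≥ r` recovers the entrywise sign of `Ω - I` and
does not increase the maximum-row-sum error. -/
theorem thresholded_precision_sign_recovery
    (d : ℕ) (hd : 1 ≤ d)
    (Om Omh Omt : Matrix (Fin d) (Fin d) ℝ)
    (r τ : ℝ) (hr : 0 ≤ r) (hτ : r ≤ τ)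
    (herr : ∀ k, ∑ l, |Omh k l - Om k l| ≤ r)
    (hdiag_ge : ∀ k, 1 ≤ Om k k)
    (hoff : ∀ k l, k ≠ l → Om k l = 0 ∨ 2 * τ < |Om k l|)
    (hdiag : ∀ k, Om k k = 1 ∨ 1 + 2 * τ < Om k k)
    (hOmt_off : ∀ k l, k ≠ l → Omt k l = if τ < |Omh k l| then Omh k l else 0)
    (hOmt_diag : ∀ k, Omt k k = if 1 + τ < Omh k k then Omh k k else 1) :
    (∀ k l, Real.sign (Omt k l - (1 : Matrix (Fin d) (Fin d) ℝ) k l) =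
      Real.sign (Om k l - (1 : Matrix (Fin d) (Fin d) ℝ) k l)) ∧
    (∀ k, ∑ l, |Omt k l - Om k l| ≤ r) := by
  have herr_entry : ∀ k l, |Omh k l - Om k l| ≤ τ := fun k l =>
    ((Finset.single_le_sum (f := fun l => |Omh k l - Om k l|) (fun _ _ => abs_nonneg _)
      (Finset.mem_univ l)).trans (herr k)).trans hτ
  have key : ∀ k l, Real.sign (Omt k l - (1 : Matrix (Fin d) (Fin d) ℝ) k l) =
      Real.sign (Om k l - (1 : Matrix (Fin d) (Fin d) ℝ) k l) ∧
      |Omt k l - Om k l| ≤ |Omh k l - Om k l| := by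
    intro k l
    have he := herr_entry k l
    rcases eq_or_ne k l with rfl | hkl
    · have hτ₀ : 0 ≤ τ := hr.trans hτ
      have hlower := (abs_le.mp he).1
      have hge := hdiag_ge k
      have hthr : τ < |Omh k k - 1| ↔ 1 + τ < Omh k k := by
        rw [lt_abs]
        constructor
        · rintro (h | h) <;> linarith
        · intro h
          left
          linarith
      have h := sign_hardThreshold_eq_and_abs_sub_le (a := Om k k - 1) (b := Omh k k - 1)
        (t := Omt k k - 1) (τ := τ) (by rwa [sub_sub_sub_cancel_right])
        ((hdiag k).imp (fun h => by linarith) (fun h => lt_abs.mpr (Or.inl (by linarith))))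
        (by simp only [hthr, hOmt_diag k]; split_ifs <;> simp)
      simpa only [Matrix.one_apply_eq, sub_sub_sub_cancel_right] using h
    · simpa only [Matrix.one_apply_ne hkl, sub_zero] using
        sign_hardThreshold_eq_and_abs_sub_le he (hoff k l hkl) (hOmt_off k l hkl)
  exact ⟨fun k l => (key k l).1,
    fun k => (Finset.sum_le_sum fun l _ => (key k l).2).trans (herr k)⟩
end
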